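/- Let k be a field in which m! is invertible, V a finite-dimensional k-vector space, and φ a nilpotent endomorphism of V. Let S ⊆ V^{⊗m} be the subspace of symmetric tensors, i.e. the elements fixed by the permutation operator P_σ for every σ ∈ Σ_m. Then both the endomorphism X = φ₁ + ⋯ + φ_m (where φ_i = 1^{⊗(i−1)}⊗φ⊗1^{⊗(m−i)}) and the endomorphism X' = (1+φ)^{⊗m} − id of V^{⊗m} map S into itself, and the restrictions X|_S and X'|_S are similar endomorphisms of S. -/

import Mathlib

open scoped TensorProduct
open PiTensorProduct

theorem DFinsupp.basis_apply {R ι : Type*} {η M : ι → Type*} [DecidableEq ι] [Semiring R]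
    [∀ i, AddCommMonoid (M i)] [∀ i, Module R (M i)] (b : ∀ i, Module.Basis (η i) R (M i))
    (p : Σ i, η i) : DFinsupp.basis b p = DFinsupp.single p.1 (b p.1 p.2) := by
  classical
  apply (DFinsupp.basis b).repr.injective
  rw [Module.Basis.repr_self]
  simp only [basis, LinearEquiv.trans_apply, mapRange.linearEquiv_apply, mapRange_single,
    Module.Basis.repr_self, sigmaFinsuppLequivDFinsupp_symm_apply, AddEquiv.toEquiv_eq_coe,
    Equiv.invFun_as_coe, AddEquiv.coe_toEquiv_symm, sigmaFinsuppAddEquivDFinsupp_symm_apply]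
  exact (Equiv.eq_symm_apply _).mpr (by simp)

open Polynomial DirectSum in
theorem exists_basis_quotient_span_X_pow (k : Type*) [Field k] (n : ℕ) :
    ∃ b : Module.Basis (Fin n) k (k[X] ⧸ k[X] ∙ (X ^ n : k[X])),
      ∀ i, b i = Submodule.Quotient.mk (X ^ (i : ℕ)) := by
  let b := (AdjoinRoot.powerBasis' (Polynomial.monic_X_pow (R := k) n)).basis
  have hb (i) : b i = AdjoinRoot.root _ ^ (i : ℕ) := by simp [b]
  have hn : (AdjoinRoot.powerBasis' (Polynomial.monic_X_pow (R := k) n)).dim = n := by simp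
  exact ⟨b.reindex (finCongr hn), fun i ↦ (b.reindex_apply _ i).trans (hb _)⟩

open Polynomial DirectSum in
/-- Jordan normal form of a nilpotent endomorphism `φ`: there is a basis made of strings
`e j, φ (e j), …, φ ^ (n j - 1) (e j)` with `φ ^ n j (e j) = 0`. -/
theorem exists_jordanBasis {k V : Type*} [Field k] [AddCommGroup V] [Module k V]
    [FiniteDimensional k V] {φ : V →ₗ[k] V} (hφ : IsNilpotent φ) :
    ∃ (d : ℕ) (n : Fin d → ℕ) (e : Fin d → V) (b : Module.Basis (Σ j, Fin (n j)) k V),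
      (∀ p, b p = (φ ^ (p.2 : ℕ)) (e p.1)) ∧ ∀ j, (φ ^ n j) (e j) = 0 := by
  have htors : Module.IsTorsion' (Module.AEval' φ) (Submonoid.powers (X : k[X])) := by
    obtain ⟨N, hN⟩ := hφ
    intro x
    obtain ⟨v, rfl⟩ := (Module.AEval'.of φ).surjective x
    refine ⟨⟨X ^ N, N, rfl⟩, ?_⟩
    change (X ^ N : k[X]) • Module.AEval'.of φ v = 0
    rw [Module.AEval'.X_pow_smul_of, hN, zero_smul, map_zero]
  obtain ⟨d, n, ⟨f⟩⟩ := Module.torsion_by_prime_power_decomposition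
    (irreducible_X (R := k)) htors
  choose b hb using fun j ↦ exists_basis_quotient_span_X_pow k (n j)
  let B : Module.Basis (Σ j, Fin (n j)) k (⨁ j : Fin d, k[X] ⧸ k[X] ∙ (X ^ n j : k[X])) :=
    DFinsupp.basis b
  let F : (⨁ j : Fin d, k[X] ⧸ k[X] ∙ (X ^ n j : k[X])) ≃ₗ[k] V :=
    (f.symm.restrictScalars k).trans (Module.AEval'.of φ).symm
  have hF (a : ℕ) (x) : (φ ^ a) (F x) = F ((X ^ a : k[X]) • x) := by
    simp [F, Module.End.smul_def]
  have key (j : Fin d) (a : ℕ) :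
      (φ ^ a) (F (DirectSum.lof k[X] _ _ j (Submodule.Quotient.mk 1))) =
        F (DirectSum.lof k[X] _ _ j (Submodule.Quotient.mk (X ^ a))) := by
    rw [hF, ← map_smul, ← Submodule.Quotient.mk_smul, smul_eq_mul, mul_one]
  refine ⟨d, n, fun j ↦ F (DirectSum.lof k[X] _ _ j (Submodule.Quotient.mk 1)), B.map F,
    fun p ↦ ?_, fun j ↦ ?_⟩
  · rw [key, Module.Basis.map_apply, ← hb]
    congr 1
    exact DFinsupp.basis_apply b p
  · rw [key, (Submodule.Quotient.mk_eq_zero _).mpr (Submodule.mem_span_singleton_self _), map_zero,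
      map_zero]

section

open MvPolynomial

open scoped IsMulCommutative in
theorem MvPolynomial.exists_algHom_of_commute {k ι B : Type*} [CommRing k] [Ring B] [Algebra k B]
    (Φ : ι → B) (h : ∀ i j, Commute (Φ i) (Φ j)) :
    ∃ ρ : MvPolynomial ι k →ₐ[k] B, ∀ i, ρ (X i) = Φ i := by
  have : IsMulCommutative (Algebra.adjoin k (Set.range Φ)) :=
    Algebra.isMulCommutative_adjoin k (by rintro _ ⟨i, rfl⟩ _ ⟨j, rfl⟩; exact h i j)
  let Ψ : ι → Algebra.adjoin k (Set.range Φ) := fun i ↦ ⟨Φ i, Algebra.subset_adjoin ⟨i, rfl⟩⟩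
  exact ⟨(Algebra.adjoin k (Set.range Φ)).val.comp (aeval Ψ), fun i ↦ by simp [Ψ]⟩

variable (k : Type*) [Field k] {ι : Type*} [Fintype ι] [DecidableEq ι]

/-- The polynomials `u i` with constant term `1` in the decomposition
`∏ i, (1 + X i) - 1 = ∑ i, X i * u i`. -/
noncomputable def unitFactor (i : ι) : MvPolynomial ι k :=
  ∑ T : Finset ι, if i ∈ T then C (T.card : k)⁻¹ * ∏ j ∈ T.erase i, X j else 0

theorem sum_X_mul_unitFactor (h : ((Fintype.card ι).factorial : k) ≠ 0) :
    ∑ i : ι, X i * unitFactor k i = ∏ i : ι, (1 + X i) - 1 := by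
  simp only [unitFactor, Finset.mul_sum, mul_ite, mul_zero]
  rw [Finset.sum_comm, Finset.prod_one_add, Finset.powerset_univ, ← Finset.add_sum_erase _ _ (Finset.mem_univ ∅),
    ← Finset.add_sum_erase _ (fun t ↦ ∏ i ∈ t, (X i : MvPolynomial ι k)) (Finset.mem_univ ∅)]
  simp only [Finset.notMem_empty, if_false, Finset.sum_const_zero, zero_add, Finset.prod_empty,
    add_sub_cancel_left]
  refine Finset.sum_congr rfl fun T hT ↦ ?_
  have hT0 : (T.card : k) ≠ 0 := fun h0 ↦ h <| by
    obtain ⟨c, hc⟩ := Nat.dvd_factorial (Finset.card_pos.mpr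
      (Finset.nonempty_iff_ne_empty.mpr (Finset.ne_of_mem_erase hT))) (Finset.card_le_univ T)
    rw [hc, Nat.cast_mul, h0, zero_mul]
  rw [← Finset.sum_filter, Finset.filter_mem_eq_inter, Finset.univ_inter]
  calc _ = ∑ i ∈ T, C (T.card : k)⁻¹ * ∏ j ∈ T, (X j : MvPolynomial ι k) :=
        Finset.sum_congr rfl fun i hi ↦ by rw [← Finset.mul_prod_erase _ _ hi]; ring
    _ = _ := by
        rw [Finset.sum_const, nsmul_eq_mul, ← mul_assoc, ← map_natCast (C (R := k) (σ := ι)), ← C_mul,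
          mul_inv_cancel₀ hT0, C_1, one_mul]

theorem constantCoeff_unitFactor (i : ι) : constantCoeff (unitFactor k i) = 1 := by
  rw [unitFactor, map_sum, Finset.sum_eq_single {i}]
  · simp
  · intro T _ hT
    split_ifs with hi
    · obtain ⟨j, hj⟩ : (T.erase i).Nonempty := by
        rw [Finset.nonempty_iff_ne_empty, Ne, Finset.erase_eq_empty_iff]
        rintro (rfl | h)
        · simp at hi
        · exact hT h
      simp [Finset.prod_eq_zero hj]
    · simp
  · simp

theorem rename_unitFactor (σ : Equiv.Perm ι) (i : ι) :
    rename σ (unitFactor k i) = unitFactor k (σ i) := by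
  rw [unitFactor, unitFactor, map_sum]
  refine Fintype.sum_equiv σ.finsetCongr _ _ fun T ↦ ?_
  have h : (T.map σ.toEmbedding).erase (σ i) = (T.erase i).map σ.toEmbedding :=
    (Finset.map_erase σ.toEmbedding T i).symm
  have hmem : σ i ∈ T.map σ.toEmbedding ↔ i ∈ T := Finset.mem_map' _
  rw [Equiv.finsetCongr_apply, h, Finset.prod_map, Finset.card_map, apply_ite (rename σ)]
  simp only [hmem, map_mul, map_prod, rename_C, rename_X, map_zero, Equiv.coe_toEmbedding]

/-- The endomorphism `X i ↦ X i * unitFactor k i` of the polynomial ring. -/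
noncomputable def twist : MvPolynomial ι k →ₐ[k] MvPolynomial ι k :=
  aeval fun i ↦ X i * unitFactor k i

theorem rename_twist (σ : Equiv.Perm ι) (f : MvPolynomial ι k) :
    rename σ (twist k f) = twist k (rename σ f) := by
  refine DFunLike.congr_fun (?_ : (rename σ).comp (twist k) = (twist k).comp (rename σ)) f
  ext i : 1
  simp [twist, rename_unitFactor]

theorem constantCoeff_twist (f : MvPolynomial ι k) :
    constantCoeff (twist k f) = constantCoeff f := by
  induction f using MvPolynomial.induction_on with
  | C a => simp [twist]
  | add p q hp hq => simp [hp, hq]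
  | mul_X p i hp => simp [twist]

/-- `twist` is congruent to the identity modulo higher powers of the ideal of the variables. -/
theorem twist_sub_mem (d : ℕ) : ∀ f ∈ idealOfVars ι k ^ d,
    twist k f - f ∈ idealOfVars ι k ^ (d + 1) := by
  have mem_iff (f : MvPolynomial ι k) : f ∈ idealOfVars ι k ↔ constantCoeff f = 0 := by
    rw [← pow_one (idealOfVars ι k), mem_pow_idealOfVars_iff', constantCoeff_eq]
    simp [Finsupp.degree_eq_zero_iff]
  have h1 : ∀ f ∈ idealOfVars ι k, twist k f - f ∈ idealOfVars ι k ^ 2 := by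
    intro f hf
    induction hf using Submodule.span_induction with
    | mem _ h =>
      obtain ⟨i, rfl⟩ := h
      have : twist k (X i) - X i = X i * (unitFactor k i - 1) := by simp [twist]; ring
      rw [this, pow_two]
      exact Ideal.mul_mem_mul ((mem_iff _).mpr (by simp))
        ((mem_iff _).mpr (by simp [constantCoeff_unitFactor]))
    | zero => simp
    | add f g _ _ hf hg =>
      rw [map_add, add_sub_add_comm]
      exact add_mem hf hg
    | smul a f hf' hf =>
      rw [smul_eq_mul, map_mul, show twist k a * twist k f - a * f
        = twist k a * (twist k f - f) + (twist k a - a) * f by ring]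
      refine add_mem (Ideal.mul_mem_left _ _ hf) ?_
      rw [pow_two]
      exact Ideal.mul_mem_mul ((mem_iff _).mpr (by simp [constantCoeff_twist])) hf'
  induction d with
  | zero => intro f _; simpa [mem_iff] using by simp [constantCoeff_twist]
  | succ d ih =>
    intro f hf
    rw [pow_succ] at hf
    induction hf using Submodule.mul_induction_on' with
    | mem_mul_mem a ha b hb =>
      rw [map_mul, show twist k a * twist k b - a * b
        = twist k a * (twist k b - b) + (twist k a - a) * b by ring]
      refine add_mem ?_ ?_
      · rw [show d + 1 + 1 = d + 2 by ring, pow_add]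
        refine Ideal.mul_mem_mul ?_ (h1 b hb)
        rw [← sub_add_cancel (twist k a) a]
        exact add_mem (Ideal.pow_le_pow_right d.le_succ (ih a ha)) ha
      · rw [pow_succ]
        exact Ideal.mul_mem_mul (ih a ha) hb
    | add f _ g _ hf hg =>
      rw [map_add, add_sub_add_comm]
      exact add_mem hf hg

end

section
variable {k : Type*} [Field k] {ι : Type*} [DecidableEq ι]
  {V : Type*} [AddCommGroup V] [Module k V]

variable (k V) in
/-- The endomorphism `1 ⊗ ⋯ ⊗ f ⊗ ⋯ ⊗ 1` of a tensor power, with `f` acting on the `i`-th factor. -/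
noncomputable def slot (i : ι) : Module.End k V →ₐ[k] Module.End k (⨂[k] _ : ι, V) :=
  AlgHom.ofLinearMap ((mapMultilinear k (fun _ : ι ↦ V) (fun _ ↦ V)).toLinearMap (fun _ ↦ 1) i)
    (by
      change PiTensorProduct.map _ = _
      rw [show Function.update (fun _ : ι ↦ (1 : Module.End k V)) i 1 = fun _ ↦ 1 from
        Function.update_eq_self i _]
      exact PiTensorProduct.map_one)
    (fun f g ↦ by
      change PiTensorProduct.map _ = PiTensorProduct.map _ * PiTensorProduct.map _
      rw [← PiTensorProduct.map_mul]
      congr 1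
      ext j : 1
      by_cases h : j = i
      · subst h; simp
      · simp [h])

theorem slot_apply (i : ι) (f : Module.End k V) :
    slot k V i f = PiTensorProduct.map (Function.update (fun _ ↦ 1) i f) := rfl

theorem commute_slot (f : Module.End k V) (i j : ι) : Commute (slot k V i f) (slot k V j f) := by
  rcases eq_or_ne i j with rfl | hij
  · exact Commute.refl _
  · simp only [slot_apply, Commute, SemiconjBy]
    rw [← PiTensorProduct.map_mul, ← PiTensorProduct.map_mul]
    congr 1
    ext l : 1
    by_cases hi : l = i
    · subst hi; simp [hij]
    · simp [hi]

theorem map_prod_eq_map [Fintype ι] {R : Type*} [CommRing R] (ρ : R →+* Module.End k (⨂[k] _ : ι, V))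
    (F : ι → R) (f : ι → Module.End k V) (h : ∀ i, ρ (F i) = slot k V i (f i)) :
    ρ (∏ i, F i) = PiTensorProduct.map f := by
  have key (s : Finset ι) : ρ (∏ i ∈ s, F i) =
      PiTensorProduct.map fun i ↦ if i ∈ s then f i else 1 := by
    induction s using Finset.induction_on with
    | empty => simp
    | insert i s hi ih =>
      rw [Finset.prod_insert hi, map_mul, ih, h, slot_apply, ← PiTensorProduct.map_mul]
      congr 1
      ext j : 1
      by_cases hj : j = i
      · subst hj; simp [hi]
      · simp [hj]
  simpa using key Finset.univ

theorem reindex_slot (σ : Equiv.Perm ι) (i : ι) (f : Module.End k V) (x : ⨂[k] _ : ι, V) :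
    reindex k (fun _ ↦ V) σ (slot k V i f x) =
      slot k V (σ i) f (reindex k (fun _ ↦ V) σ x) := by
  rw [slot_apply, slot_apply, ← map_reindex]
  congr 2
  ext j : 1
  by_cases h : j = σ i
  · subst h; simp
  · simp [h, Equiv.symm_apply_eq]

open MvPolynomial in
theorem reindex_algHom_apply {φ : Module.End k V}
    {ρ : MvPolynomial ι k →ₐ[k] Module.End k (⨂[k] _ : ι, V)} (hρ : ∀ i, ρ (X i) = slot k V i φ)
    (σ : Equiv.Perm ι) (f : MvPolynomial ι k) (x : ⨂[k] _ : ι, V) :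
    reindex k (fun _ ↦ V) σ (ρ f x) = ρ (rename σ f) (reindex k (fun _ ↦ V) σ x) := by
  induction f using MvPolynomial.induction_on generalizing x with
  | C a =>
    rw [rename_C, ← algebraMap_eq, AlgHom.commutes, Module.algebraMap_end_apply,
      Module.algebraMap_end_apply, map_smul]
  | add p q hp hq => simp only [map_add, LinearMap.add_apply, hp, hq]
  | mul_X p i hp =>
    simp only [map_mul, Module.End.mul_apply, rename_X, hp, hρ, reindex_slot]

open MvPolynomial in
/-- The operators `∑ i, φ_i` and `(1 + φ)^{⊗ι} - 1` are conjugate by an automorphism of the tensor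
power commuting with permutations. On a tensor `E J` of Jordan generators, the automorphism sends
`f(φ_1, …, φ_m) (E J)` to `(twist f)(φ_1, …, φ_m) (E J)`. -/
theorem exists_equivariant_intertwiner [Fintype ι] [FiniteDimensional k V]
    (hι : ((Fintype.card ι).factorial : k) ≠ 0) {φ : Module.End k V} (hφ : IsNilpotent φ) :
    ∃ g : Module.End k (⨂[k] _ : ι, V), Function.Bijective g ∧
      g * ∑ i, slot k V i φ = (PiTensorProduct.map (fun _ ↦ 1 + φ) - 1) * g ∧
      ∀ (σ : Equiv.Perm ι) x, g (reindex k (fun _ ↦ V) σ x) = reindex k (fun _ ↦ V) σ (g x) := by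
  obtain ⟨d, n, e, b, hb, he⟩ := exists_jordanBasis hφ
  obtain ⟨ρ, hρ⟩ := MvPolynomial.exists_algHom_of_commute (k := k) (fun i : ι ↦ slot k V i φ)
    (commute_slot φ)
  let E (J : ι → Fin d) : ⨂[k] _ : ι, V := ⨂ₜ[k] i, e (J i)
  have hmon (a : ι → ℕ) (J : ι → Fin d) :
      ρ (∏ i, X i ^ a i) (E J) = ⨂ₜ[k] i, (φ ^ a i) (e (J i)) := by
    have := map_prod_eq_map (ρ : MvPolynomial ι k →+* _) (fun i ↦ X i ^ a i) (fun i ↦ φ ^ a i)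
      (fun i ↦ by simp [hρ])
    rw [RingHom.coe_coe] at this
    rw [this, map_tprod]
  let T := Basis.piTensorProduct fun _ : ι ↦ b
  have hT (p : ι → Σ j, Fin (n j)) :
      T p = ρ (∏ i, X i ^ ((p i).2 : ℕ)) (E fun i ↦ (p i).1) := by
    rw [hmon, Basis.piTensorProduct_apply]
    simp only [hb]
  let g : Module.End k (⨂[k] _ : ι, V) :=
    T.constr k fun p ↦ ρ (twist k (∏ i, X i ^ ((p i).2 : ℕ))) (E fun i ↦ (p i).1)
  have hg (f : MvPolynomial ι k) (J : ι → Fin d) : g (ρ f (E J)) = ρ (twist k f) (E J) := by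
    induction f using MvPolynomial.induction_on' with
    | add p q hp hq => simp only [map_add, LinearMap.add_apply, hp, hq]
    | monomial a r =>
      suffices h : g (ρ (∏ i, X i ^ a i) (E J)) = ρ (twist k (∏ i, X i ^ a i)) (E J) by
        rw [monomial_eq, Finsupp.prod_fintype _ _ (fun _ ↦ pow_zero _), ← smul_eq_C_mul]
        simp only [map_smul, LinearMap.smul_apply, h]
      by_cases ha : ∀ i, a i < n (J i)
      · let p : ι → Σ j, Fin (n j) := fun i ↦ ⟨J i, a i, ha i⟩
        rw [← hT p]
        exact T.constr_basis k _ p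
      · push Not at ha
        obtain ⟨i, hi⟩ := ha
        have h0 : ρ (∏ i, X i ^ a i) (E J) = 0 := by
          rw [hmon]
          refine (PiTensorProduct.tprod k).map_coord_zero i ?_
          rw [← Nat.sub_add_cancel hi, pow_add, Module.End.mul_apply, he, map_zero]
        have h1 : twist k (∏ i, X i ^ a i) =
            (∏ i, unitFactor k i ^ a i) * ∏ i : ι, (X i : MvPolynomial ι k) ^ a i := by
          simp [twist, mul_pow, Finset.prod_mul_distrib, mul_comm]
        rw [h1, map_mul, Module.End.mul_apply, h0, map_zero, map_zero]
  have hext {L₁ L₂ : Module.End k (⨂[k] _ : ι, V)} (h : ∀ f J, L₁ (ρ f (E J)) = L₂ (ρ f (E J))) :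
      L₁ = L₂ := T.ext fun p ↦ by rw [hT]; exact h _ _
  have hsemi (f : MvPolynomial ι k) : g * ρ f = ρ (twist k f) * g := hext fun f' J ↦ by
    rw [Module.End.mul_apply, Module.End.mul_apply, hg, ← Module.End.mul_apply (ρ f),
      ← map_mul, hg, map_mul, map_mul, Module.End.mul_apply]
  have hnil : ∃ N, ∀ f ∈ idealOfVars ι k ^ N, ρ f = 0 := by
    obtain ⟨r, hr⟩ := hφ
    obtain ⟨N, hN⟩ := Ideal.exists_pow_le_of_le_radical_of_fg (I := idealOfVars ι k)
      (J := RingHom.ker ρ) (by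
        rw [idealOfVars, Ideal.span_le]
        rintro _ ⟨i, rfl⟩
        exact ⟨r, by rw [RingHom.mem_ker, map_pow, hρ, ← map_pow, hr, map_zero]⟩)
      (idealOfVars_fg ι k)
    exact ⟨N, fun f hf ↦ hN hf⟩
  obtain ⟨N, hN⟩ := hnil
  have hrange : ∀ c ≤ N, ∀ f ∈ idealOfVars ι k ^ c, ∀ J, ρ f (E J) ∈ LinearMap.range g := by
    intro c hc
    induction hc using Nat.decreasingInduction with
    | self => intro f hf J; rw [hN f hf]; exact zero_mem _
    | of_succ c _ ih =>
      intro f hf J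
      have h := sub_mem (LinearMap.mem_range_self g (ρ f (E J))) (ih _ (twist_sub_mem k c f hf) J)
      rwa [hg, map_sub, LinearMap.sub_apply, sub_sub_cancel] at h
  have hsurj : Function.Surjective g := by
    rw [← LinearMap.range_eq_top, eq_top_iff, ← T.span_eq, Submodule.span_le]
    rintro _ ⟨p, rfl⟩
    rw [hT]
    exact hrange 0 (Nat.zero_le _) _ (by simp) _
  have : FiniteDimensional k (⨂[k] _ : ι, V) := Module.Finite.of_basis T
  refine ⟨g, ⟨LinearMap.injective_iff_surjective.mpr hsurj, hsurj⟩, ?_, fun σ x ↦ ?_⟩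
  · have h := hsemi (∑ i, X i)
    have h1 : twist k (∑ i : ι, X i) = ∏ i : ι, (1 + X i) - 1 := by
      rw [← sum_X_mul_unitFactor k hι]; simp [twist]
    have h2 := map_prod_eq_map (ρ : MvPolynomial ι k →+* _) (fun i ↦ 1 + X i) (fun _ ↦ 1 + φ)
      (fun i ↦ by simp [hρ])
    rw [RingHom.coe_coe] at h2
    rw [h1, map_sub, h2, map_one, map_sum] at h
    simpa only [hρ] using h
  · let P : Module.End k (⨂[k] _ : ι, V) := (reindex k (fun _ : ι ↦ V) σ).toLinearMap
    have hP : g * P = P * g := hext fun f J ↦ by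
      have hPE : P (E J) = E fun i ↦ J (σ.symm i) := reindex_tprod _ _
      have hPρ (f x) : P (ρ f x) = ρ (rename σ f) (P x) := reindex_algHom_apply hρ σ f x
      simp only [Module.End.mul_apply, hg, hPρ, hPE, rename_twist]
    exact DFunLike.congr_fun hP x

end

/-- Let `k` be a field in which `m!` is invertible, `V` a
finite-dimensional `k`-vector space, `φ` a nilpotent endomorphism of `V`, and
`S ⊆ V^{⊗m}` the subspace of symmetric tensors (fixed points of all permutation
operators `P_σ`).  Then both `X = φ₁ + ⋯ + φ_m` and `X' = (1+φ)^{⊗m} − id` map `S`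
into itself, and the restrictions `X|_S` and `X'|_S` are similar endomorphisms
of `S`. -/
theorem stmt9 (k : Type*) [Field k] (m : ℕ)
    (hm : (Nat.factorial m : k) ≠ 0)
    (V : Type*) [AddCommGroup V] [Module k V] [FiniteDimensional k V]
    (φ : V →ₗ[k] V) (hφ : IsNilpotent φ)
    (S : Submodule k (⨂[k] _ : Fin m, V))
    (hS : ∀ x : ⨂[k] _ : Fin m, V, x ∈ S ↔ ∀ σ : Equiv.Perm (Fin m),
      PiTensorProduct.reindex k (fun _ : Fin m => V) σ x = x)
    (X X' : (⨂[k] _ : Fin m, V) →ₗ[k] (⨂[k] _ : Fin m, V))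
    (hXdef : X = ∑ i : Fin m, PiTensorProduct.map
      (Function.update (fun _ : Fin m => (LinearMap.id : V →ₗ[k] V)) i φ))
    (hX'def : X' = PiTensorProduct.map
      (fun _ : Fin m => (LinearMap.id : V →ₗ[k] V) + φ) - LinearMap.id) :
    ∃ (hX : ∀ x ∈ S, X x ∈ S) (hX' : ∀ x ∈ S, X' x ∈ S),
      ∃ g : S ≃ₗ[k] S,
        (g : S →ₗ[k] S) ∘ₗ LinearMap.restrict X hX =
          LinearMap.restrict X' hX' ∘ₗ (g : S →ₗ[k] S) := by
  have hX1 : X = ∑ i, slot k V i φ := hXdef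
  have hX2 : X' = PiTensorProduct.map (fun _ ↦ 1 + φ) - 1 := hX'def
  obtain ⟨g, hgbij, hgX, hgσ⟩ := exists_equivariant_intertwiner (ι := Fin m) (by simpa using hm) hφ
  rw [← hX1, ← hX2] at hgX
  have hX : ∀ x ∈ S, X x ∈ S := fun x hx ↦ (hS _).mpr fun σ ↦ by
    rw [hX1, LinearMap.sum_apply, map_sum]
    simp only [reindex_slot, (hS x).mp hx σ]
    exact Equiv.sum_comp σ fun i ↦ slot k V i φ x
  have hX' : ∀ x ∈ S, X' x ∈ S := fun x hx ↦ (hS _).mpr fun σ ↦ by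
    rw [hX2, LinearMap.sub_apply, map_sub, Module.End.one_apply]
    have h := map_reindex (fun _ : Fin m ↦ 1 + φ) σ x
    simp only [(hS x).mp hx σ] at h ⊢
    rw [← h]
  have hgS : ∀ x ∈ S, g x ∈ S := fun x hx ↦ (hS _).mpr fun σ ↦ by rw [← hgσ, (hS x).mp hx σ]
  have hgS' : ∀ x, g x ∈ S → x ∈ S := fun x hx ↦ (hS _).mpr fun σ ↦
    hgbij.1 <| by rw [hgσ, (hS _).mp hx σ]
  refine ⟨hX, hX', LinearEquiv.ofBijective (g.restrict hgS) ⟨fun x y h ↦ ?_, fun y ↦ ?_⟩, ?_⟩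
  · exact Subtype.ext (hgbij.1 (congrArg Subtype.val h))
  · obtain ⟨x, hx⟩ := hgbij.2 y
    exact ⟨⟨x, hgS' x (hx ▸ y.2)⟩, Subtype.ext hx⟩
  · ext x
    exact DFunLike.congr_fun hgX (x : ⨂[k] _ : Fin m, V)
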